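/- Let S and A be positive integers, γ ∈ (0,1), P ∈ ℝ^{SA×S} row-stochastic, ρ ∈ ℝ^S a probability vector, Ξ = 1_A ⊗ I_S, c ∈ ℝ^{SA}, σ > 0, w ∈ ℝ^{SA}, and let D be the occupancy polytope. Define κ(V,φ) = −(σ/2)‖c + γPV − ΞV − φ‖² + w^⊤(c + γPV − ΞV − φ) + (1−γ)ρ^⊤V for V ∈ ℝ^S and φ ∈ ℝ^{SA}. Then strong duality holds: min_{d ∈ D} ( c^⊤ d + (1/(2σ))‖d − w‖² ) = sup_{V ∈ ℝ^S, φ ≥ 0} κ(V,φ), and the supremum is attained at some (V*, φ*) with φ* ≥ 0. -/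

import Mathlib

open Matrix Filter Topology

noncomputable def eucNorm {ι : Type*} [Fintype ι] (x : ι → ℝ) : ℝ :=
  Real.sqrt (∑ i, x i ^ 2)

def RowStochastic {m n : Type*} [Fintype n] (P : Matrix m n ℝ) : Prop :=
  (∀ i j, 0 ≤ P i j) ∧ ∀ i, ∑ j, P i j = 1

def Xi (S A : ℕ) : Matrix (Fin S × Fin A) (Fin S) ℝ :=
  Matrix.of fun p s' => if p.1 = s' then 1 else 0

def OccD (S A : ℕ) (γ : ℝ) (P : Matrix (Fin S × Fin A) (Fin S) ℝ)
    (ρ : Fin S → ℝ) : Set ((Fin S × Fin A) → ℝ) :=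
  {d | (∀ p, 0 ≤ d p) ∧
    ∀ s, ∑ a, d (s, a) = (1 - γ) * ρ s + γ * ∑ p : Fin S × Fin A, P p s * d p}

noncomputable def kappa (S A : ℕ) (γ σ : ℝ) (P : Matrix (Fin S × Fin A) (Fin S) ℝ)
    (ρ : Fin S → ℝ) (c w : (Fin S × Fin A) → ℝ)
    (V : Fin S → ℝ) (φ : (Fin S × Fin A) → ℝ) : ℝ :=
  -(σ / 2) * eucNorm (c + γ • P.mulVec V - (Xi S A).mulVec V - φ) ^ 2
    + ∑ p, w p * (c + γ • P.mulVec V - (Xi S A).mulVec V - φ) p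
    + (1 - γ) * ∑ s, ρ s * V s

noncomputable def regObj {ι : Type*} [Fintype ι] (σ : ℝ) (c w d : ι → ℝ) : ℝ :=
  (∑ p, c p * d p) + (1 / (2 * σ)) * eucNorm (d - w) ^ 2

lemma eucNorm_sq {ι : Type*} [Fintype ι] (x : ι → ℝ) : eucNorm x ^ 2 = ∑ i, x i ^ 2 :=
  Real.sq_sqrt (Finset.sum_nonneg fun i _ => sq_nonneg (x i))

lemma Xi_mulVec_apply {S A : ℕ} (V : Fin S → ℝ) (p : Fin S × Fin A) :
    (Xi S A).mulVec V p = V p.1 := by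
  simp [Xi, Matrix.mulVec, dotProduct]

/-- The Bellman flow equation tested against a value function. -/
lemma OccD.sum_mul_bellman {S A : ℕ} {γ : ℝ} {P : Matrix (Fin S × Fin A) (Fin S) ℝ}
    {ρ : Fin S → ℝ} {d : Fin S × Fin A → ℝ} (hd : d ∈ OccD S A γ P ρ) (V : Fin S → ℝ) :
    ∑ p, d p * (V p.1 - γ * P.mulVec V p) = (1 - γ) * ∑ s, ρ s * V s := by
  have h1 : ∑ p, d p * V p.1 = ∑ s, (∑ a, d (s, a)) * V s := by
    simp only [Fintype.sum_prod_type, Finset.sum_mul]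
  have h2 : ∑ p, d p * P.mulVec V p = ∑ s, (∑ p, P p s * d p) * V s := by
    simp only [Matrix.mulVec, dotProduct, Finset.sum_mul, Finset.mul_sum]
    rw [Finset.sum_comm]
    exact Finset.sum_congr rfl fun s _ => Finset.sum_congr rfl fun p _ => by ring
  calc ∑ p, d p * (V p.1 - γ * P.mulVec V p)
      = ∑ p, d p * V p.1 - γ * ∑ p, d p * P.mulVec V p := by
        rw [Finset.mul_sum, ← Finset.sum_sub_distrib]
        exact Finset.sum_congr rfl fun p _ => by ring
    _ = (1 - γ) * ∑ s, ρ s * V s := by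
        rw [h1, h2, Finset.mul_sum, Finset.mul_sum, ← Finset.sum_sub_distrib]
        refine Finset.sum_congr rfl fun s _ => ?_
        rw [hd.2 s]
        ring

/-- Occupancy vectors have total mass one. -/
lemma OccD.sum_eq_one {S A : ℕ} {γ : ℝ} (hγ1 : γ < 1)
    {P : Matrix (Fin S × Fin A) (Fin S) ℝ} (hP : RowStochastic P)
    {ρ : Fin S → ℝ} (hρ1 : ∑ s, ρ s = 1)
    {d : Fin S × Fin A → ℝ} (hd : d ∈ OccD S A γ P ρ) : ∑ p, d p = 1 := by
  have h := OccD.sum_mul_bellman hd fun _ => 1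
  simp only [Matrix.mulVec, dotProduct, mul_one, hP.2, hρ1, ← Finset.sum_mul] at h
  have h' : (1 - γ) * (∑ p, d p - 1) = 0 := by linarith
  rcases mul_eq_zero.1 h' with h0 | h0 <;> linarith

lemma isCompact_OccD {S A : ℕ} {γ : ℝ} (hγ1 : γ < 1)
    {P : Matrix (Fin S × Fin A) (Fin S) ℝ} (hP : RowStochastic P)
    {ρ : Fin S → ℝ} (hρ1 : ∑ s, ρ s = 1) : IsCompact (OccD S A γ P ρ) := by
  have hclosed : IsClosed (OccD S A γ P ρ) := by
    simp only [OccD, Set.ofPred_and, Set.ofPred_forall]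
    refine (isClosed_iInter fun p => isClosed_le (by fun_prop) (by fun_prop)).inter
      (isClosed_iInter fun s => isClosed_eq (by fun_prop) (by fun_prop))
  refine (isCompact_Icc (a := (0 : Fin S × Fin A → ℝ)) (b := 1)).of_isClosed_subset hclosed ?_
  intro d hd
  refine ⟨hd.1, fun p => ?_⟩
  rw [Pi.one_apply, ← OccD.sum_eq_one hγ1 hP hρ1 hd]
  exact Finset.single_le_sum (fun q _ => hd.1 q) (Finset.mem_univ p)

lemma convex_OccD {S A : ℕ} {γ : ℝ} {P : Matrix (Fin S × Fin A) (Fin S) ℝ}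
    {ρ : Fin S → ℝ} : Convex ℝ (OccD S A γ P ρ) := by
  intro x hx y hy a b ha hb hab
  refine ⟨fun p => add_nonneg (mul_nonneg ha (hx.1 p)) (mul_nonneg hb (hy.1 p)), fun s => ?_⟩
  have h : ∑ p, P p s * (a • x + b • y) p = a * ∑ p, P p s * x p + b * ∑ p, P p s * y p := by
    rw [Finset.mul_sum, Finset.mul_sum, ← Finset.sum_add_distrib]
    refine Finset.sum_congr rfl fun p _ => ?_
    simp only [Pi.add_apply, Pi.smul_apply, smul_eq_mul]
    ring
  rw [h]
  simp only [Pi.add_apply, Pi.smul_apply, smul_eq_mul, Finset.sum_add_distrib, ← Finset.mul_sum,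
    hx.2 s, hy.2 s]
  linear_combination (1 - γ) * ρ s * hab

/-- The state distribution after `k` steps of the Markov chain with transition matrix `Q`. -/
def chainDist {ι : Type*} [Fintype ι] (Q : Matrix ι ι ℝ) (ρ : ι → ℝ) : ℕ → ι → ℝ
  | 0 => ρ
  | k + 1 => fun s => ∑ t, Q t s * chainDist Q ρ k t

lemma chainDist_nonneg {ι : Type*} [Fintype ι] {Q : Matrix ι ι ℝ} (hQ : RowStochastic Q)
    {ρ : ι → ℝ} (hρ0 : ∀ s, 0 ≤ ρ s) (k : ℕ) (s : ι) : 0 ≤ chainDist Q ρ k s := by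
  induction k generalizing s with
  | zero => exact hρ0 s
  | succ k ih => exact Finset.sum_nonneg fun t _ => mul_nonneg (hQ.1 t s) (ih t)

lemma sum_chainDist {ι : Type*} [Fintype ι] {Q : Matrix ι ι ℝ} (hQ : RowStochastic Q)
    (ρ : ι → ℝ) (k : ℕ) : ∑ s, chainDist Q ρ k s = ∑ s, ρ s := by
  induction k with
  | zero => rfl
  | succ k ih =>
    simp only [chainDist]
    rw [Finset.sum_comm, ← ih]
    exact Finset.sum_congr rfl fun t _ => by rw [← Finset.sum_mul, hQ.2 t, one_mul]

/-- Existence of the discounted occupancy measure of a Markov chain. -/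
lemma exists_discounted_occupancy {ι : Type*} [Fintype ι] {γ : ℝ} (hγ0 : 0 ≤ γ) (hγ1 : γ < 1)
    {Q : Matrix ι ι ℝ} (hQ : RowStochastic Q) {ρ : ι → ℝ} (hρ0 : ∀ s, 0 ≤ ρ s) :
    ∃ x : ι → ℝ, (∀ s, 0 ≤ x s) ∧ ∀ s, x s = (1 - γ) * ρ s + γ * ∑ t, Q t s * x t := by
  have hsum (s : ι) : Summable fun k => γ ^ k * chainDist Q ρ k s := by
    refine Summable.of_nonneg_of_le
      (fun k => mul_nonneg (pow_nonneg hγ0 k) (chainDist_nonneg hQ hρ0 k s)) (fun k => ?_)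
      ((summable_geometric_of_lt_one hγ0 hγ1).mul_right (∑ s, ρ s))
    refine mul_le_mul_of_nonneg_left ?_ (pow_nonneg hγ0 k)
    rw [← sum_chainDist hQ ρ k]
    exact Finset.single_le_sum (fun t _ => chainDist_nonneg hQ hρ0 k t) (Finset.mem_univ s)
  refine ⟨fun s => (1 - γ) * ∑' k, γ ^ k * chainDist Q ρ k s, fun s =>
    mul_nonneg (by linarith) (tsum_nonneg fun k =>
      mul_nonneg (pow_nonneg hγ0 k) (chainDist_nonneg hQ hρ0 k s)), fun s => ?_⟩
  have hstep : ∑' k, γ ^ (k + 1) * chainDist Q ρ (k + 1) s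
      = γ * ∑ t, Q t s * ∑' k, γ ^ k * chainDist Q ρ k t := by
    simp only [← tsum_mul_left]
    rw [← Summable.tsum_finsetSum fun t _ => (hsum t).mul_left _, ← tsum_mul_left]
    refine tsum_congr fun k => ?_
    simp only [chainDist, Finset.mul_sum]
    exact Finset.sum_congr rfl fun t _ => by ring
  have hfactor : ∑ t, Q t s * ((1 - γ) * ∑' k, γ ^ k * chainDist Q ρ k t)
      = (1 - γ) * ∑ t, Q t s * ∑' k, γ ^ k * chainDist Q ρ k t := by
    rw [Finset.mul_sum]
    exact Finset.sum_congr rfl fun t _ => by ring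
  beta_reduce
  rw [(hsum s).tsum_eq_zero_add, hstep, hfactor]
  simp only [chainDist, pow_zero]
  ring

/-- Every deterministic stationary policy has an occupancy vector supported on its graph. -/
lemma exists_mem_OccD_of_policy {S A : ℕ} {γ : ℝ} (hγ0 : 0 ≤ γ) (hγ1 : γ < 1)
    {P : Matrix (Fin S × Fin A) (Fin S) ℝ} (hP : RowStochastic P)
    {ρ : Fin S → ℝ} (hρ0 : ∀ s, 0 ≤ ρ s) (π : Fin S → Fin A) :
    ∃ d ∈ OccD S A γ P ρ, ∀ p, p.2 ≠ π p.1 → d p = 0 := by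
  obtain ⟨x, hx0, hx⟩ := exists_discounted_occupancy hγ0 hγ1
    (Q := Matrix.of fun s t => P (s, π s) t) ⟨fun s t => hP.1 _ t, fun s => hP.2 _⟩ hρ0
  refine ⟨fun p => if p.2 = π p.1 then x p.1 else 0, ⟨fun p => ?_, fun s => ?_⟩,
    fun p hp => if_neg hp⟩
  · dsimp only
    split_ifs
    exacts [hx0 _, le_rfl]
  · simpa [Fintype.sum_prod_type] using hx s

/-- The Bellman optimality equation has a solution, together with a greedy policy. -/
lemma exists_bellman_solution {S A : ℕ} (hA : 0 < A) {γ : ℝ} (hγ0 : 0 ≤ γ) (hγ1 : γ < 1)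
    {P : Matrix (Fin S × Fin A) (Fin S) ℝ} (hP : RowStochastic P) (g : Fin S × Fin A → ℝ) :
    ∃ (V : Fin S → ℝ) (π : Fin S → Fin A),
      (∀ p, V p.1 ≤ g p + γ * P.mulVec V p) ∧
      ∀ s, V s = g (s, π s) + γ * P.mulVec V (s, π s) := by
  have hne : (Finset.univ : Finset (Fin A)).Nonempty := ⟨⟨0, hA⟩, Finset.mem_univ _⟩
  let T : (Fin S → ℝ) → Fin S → ℝ := fun V s =>
    Finset.univ.inf' hne fun a => g (s, a) + γ * P.mulVec V (s, a)
  have hmul (V W : Fin S → ℝ) (p : Fin S × Fin A) :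
      P.mulVec V p ≤ P.mulVec W p + dist V W := by
    have h : dist V W = ∑ t, P p t * dist V W := by rw [← Finset.sum_mul, hP.2 p, one_mul]
    rw [h]
    simp only [Matrix.mulVec, dotProduct]
    rw [← Finset.sum_add_distrib]
    refine Finset.sum_le_sum fun t _ => ?_
    rw [← mul_add]
    refine mul_le_mul_of_nonneg_left ?_ (hP.1 p t)
    have h1 := dist_le_pi_dist V W t
    rw [Real.dist_eq] at h1
    linarith [le_abs_self (V t - W t)]
  have hT (V W : Fin S → ℝ) (s : Fin S) : T V s ≤ T W s + γ * dist V W := by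
    obtain ⟨a, -, ha⟩ := Finset.exists_mem_eq_inf' hne
      fun a => g (s, a) + γ * P.mulVec W (s, a)
    have h1 : T V s ≤ g (s, a) + γ * P.mulVec V (s, a) :=
      Finset.inf'_le _ (Finset.mem_univ a)
    have h2 : T W s = g (s, a) + γ * P.mulVec W (s, a) := ha
    have h3 := mul_le_mul_of_nonneg_left (hmul V W (s, a)) hγ0
    linarith
  have hcontr : ContractingWith ⟨γ, hγ0⟩ T := by
    refine ⟨by exact_mod_cast hγ1, LipschitzWith.of_dist_le_mul fun V W => ?_⟩
    rw [dist_pi_le_iff (by positivity)]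
    intro s
    rw [Real.dist_eq, abs_le]
    have h1 := hT V W s
    have h2 := hT W V s
    rw [dist_comm W V] at h2
    constructor <;> dsimp only [NNReal.toReal] <;> linarith
  obtain ⟨V, hV⟩ : ∃ V, T V = V := ⟨_, hcontr.fixedPoint_isFixedPt⟩
  choose π _ hπ using fun s => Finset.exists_mem_eq_inf' hne
    fun a => g (s, a) + γ * P.mulVec V (s, a)
  refine ⟨V, π, fun p => ?_, fun s => (congrFun hV s).symm.trans (hπ s)⟩
  rw [← congrFun hV p.1]
  exact Finset.inf'_le _ (Finset.mem_univ p.2)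

lemma regObj_eq_sum {ι : Type*} [Fintype ι] (σ : ℝ) (c w d : ι → ℝ) :
    regObj σ c w d = ∑ p, (c p * d p + 1 / (2 * σ) * (d p - w p) ^ 2) := by
  rw [regObj, eucNorm_sq, Finset.mul_sum, ← Finset.sum_add_distrib]
  rfl

/-- First-order optimality condition for the regularized objective on a convex set. -/
lemma regObj_first_order {ι : Type*} [Fintype ι] {σ : ℝ} {c w d e : ι → ℝ}
    {D : Set (ι → ℝ)} (hD : Convex ℝ D) (hd : d ∈ D) (he : e ∈ D)
    (hmin : ∀ x ∈ D, regObj σ c w d ≤ regObj σ c w x) :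
    ∑ p, (c p + (d p - w p) / σ) * d p ≤ ∑ p, (c p + (d p - w p) / σ) * e p := by
  set a := ∑ p, (c p + (d p - w p) / σ) * (e p - d p) with ha
  set b := ∑ p, 1 / (2 * σ) * (e p - d p) ^ 2 with hb
  have hexp (t : ℝ) : regObj σ c w (d + t • (e - d)) = regObj σ c w d + t * a + t ^ 2 * b := by
    rw [regObj_eq_sum, regObj_eq_sum, ha, hb, Finset.mul_sum, Finset.mul_sum,
      ← Finset.sum_add_distrib, ← Finset.sum_add_distrib]
    refine Finset.sum_congr rfl fun p _ => ?_
    simp only [Pi.add_apply, Pi.smul_apply, Pi.sub_apply, smul_eq_mul]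
    ring
  have hpos (t : ℝ) (ht : t ∈ Set.Ioc (0 : ℝ) 1) : 0 ≤ a + t * b := by
    have h := hmin _ (hD.add_smul_sub_mem hd he ⟨ht.1.le, ht.2⟩)
    rw [hexp] at h
    have h' : 0 ≤ t * (a + t * b) := by linarith
    exact nonneg_of_mul_nonneg_right h' ht.1
  have hlim : Tendsto (fun t : ℝ => a + t * b) (𝓝[>] 0) (𝓝 a) := by
    have : Continuous fun t : ℝ => a + t * b := by fun_prop
    simpa using (this.tendsto 0).mono_left nhdsWithin_le_nhds
  have h0 : 0 ≤ a := ge_of_tendsto hlim <| by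
    filter_upwards [Ioc_mem_nhdsGT (zero_lt_one' ℝ)] with t ht using hpos t ht
  have : a = ∑ p, (c p + (d p - w p) / σ) * e p - ∑ p, (c p + (d p - w p) / σ) * d p := by
    rw [ha, ← Finset.sum_sub_distrib]
    exact Finset.sum_congr rfl fun p _ => by ring
  linarith

/-- On the occupancy polytope the linear dual term can be rewritten through a primal point. -/
lemma kappa_eq_sum {S A : ℕ} {γ σ : ℝ} {P : Matrix (Fin S × Fin A) (Fin S) ℝ}
    {ρ : Fin S → ℝ} {d : Fin S × Fin A → ℝ} (hd : d ∈ OccD S A γ P ρ)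
    (c w : Fin S × Fin A → ℝ) (V : Fin S → ℝ) (φ : Fin S × Fin A → ℝ) :
    kappa S A γ σ P ρ c w V φ =
      ∑ p, (-(σ / 2) * (c p + γ * P.mulVec V p - V p.1 - φ p) ^ 2
        + w p * (c p + γ * P.mulVec V p - V p.1 - φ p)
        + d p * (V p.1 - γ * P.mulVec V p)) := by
  rw [kappa, eucNorm_sq, ← OccD.sum_mul_bellman hd V, Finset.mul_sum, ← Finset.sum_add_distrib,
    ← Finset.sum_add_distrib]
  simp only [Pi.add_apply, Pi.sub_apply, Pi.smul_apply, smul_eq_mul, Xi_mulVec_apply]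

lemma kappa_le_regObj {S A : ℕ} {γ σ : ℝ} (hσ : 0 < σ)
    {P : Matrix (Fin S × Fin A) (Fin S) ℝ} {ρ : Fin S → ℝ} {d : Fin S × Fin A → ℝ}
    (hd : d ∈ OccD S A γ P ρ) (c w : Fin S × Fin A → ℝ) (V : Fin S → ℝ)
    {φ : Fin S × Fin A → ℝ} (hφ : ∀ p, 0 ≤ φ p) :
    kappa S A γ σ P ρ c w V φ ≤ regObj σ c w d := by
  rw [kappa_eq_sum hd, regObj_eq_sum]
  refine Finset.sum_le_sum fun p _ => ?_
  set r := c p + γ * P.mulVec V p - V p.1 - φ p with hr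
  have h1 : V p.1 - γ * P.mulVec V p = c p - φ p - r := by rw [hr]; ring
  have h2 : c p * d p + 1 / (2 * σ) * (d p - w p) ^ 2
      - (-(σ / 2) * r ^ 2 + w p * r + d p * (c p - φ p - r))
      = d p * φ p + 1 / (2 * σ) * (d p - w p + σ * r) ^ 2 := by
    field_simp
    ring
  have h3 : 0 ≤ d p * φ p + 1 / (2 * σ) * (d p - w p + σ * r) ^ 2 :=
    add_nonneg (mul_nonneg (hd.1 p) (hφ p)) (by positivity)
  rw [h1]
  linarith

/-- strong duality between the regularized MDP and its dual,
with dual attainment. -/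
theorem regularized_mdp_strong_duality
    (S A : ℕ) (hS : 0 < S) (hA : 0 < A)
    (γ : ℝ) (hγ0 : 0 < γ) (hγ1 : γ < 1)
    (P : Matrix (Fin S × Fin A) (Fin S) ℝ) (hP : RowStochastic P)
    (ρ : Fin S → ℝ) (hρ0 : ∀ s, 0 ≤ ρ s) (hρ1 : ∑ s, ρ s = 1)
    (c : (Fin S × Fin A) → ℝ) (σ : ℝ) (hσ : 0 < σ) (w : (Fin S × Fin A) → ℝ) :
    ∃ m : ℝ,
      IsLeast ((fun d => regObj σ c w d) '' OccD S A γ P ρ) m ∧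
      IsGreatest {x : ℝ | ∃ (V : Fin S → ℝ) (φ : (Fin S × Fin A) → ℝ),
        (∀ p, 0 ≤ φ p) ∧ x = kappa S A γ σ P ρ c w V φ} m := by
  obtain ⟨d₀, hd₀, -⟩ := exists_mem_OccD_of_policy hγ0.le hγ1 hP hρ0 fun _ => (⟨0, hA⟩ : Fin A)
  have hcont : Continuous fun d => regObj σ c w d := by
    simp only [regObj_eq_sum]
    fun_prop
  obtain ⟨d, hd, hmin⟩ := (isCompact_OccD hγ1 hP hρ1).exists_isMinOn ⟨d₀, hd₀⟩ hcont.continuousOn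
  set g : Fin S × Fin A → ℝ := fun p => c p + (d p - w p) / σ with hg
  obtain ⟨V, π, hV, hπ⟩ := exists_bellman_solution hA hγ0.le hγ1 hP g
  obtain ⟨e, he, hsupp⟩ := exists_mem_OccD_of_policy hγ0.le hγ1 hP hρ0 π
  have hopt : ∑ p, g p * d p ≤ ∑ p, g p * e p :=
    regObj_first_order convex_OccD hd he fun x hx => hmin hx
  set φ : Fin S × Fin A → ℝ := fun p => g p + γ * P.mulVec V p - V p.1 with hφ
  have hφ0 (p) : 0 ≤ φ p := sub_nonneg.2 (hV p)
  have hsplit {x : Fin S × Fin A → ℝ} (hx : x ∈ OccD S A γ P ρ) :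
      ∑ p, g p * x p = (1 - γ) * ∑ s, ρ s * V s + ∑ p, x p * φ p := by
    rw [← OccD.sum_mul_bellman hx V, ← Finset.sum_add_distrib]
    exact Finset.sum_congr rfl fun p _ => by rw [hφ]; ring
  have hφe : ∑ p, e p * φ p = 0 := by
    refine Finset.sum_eq_zero fun ⟨s, a⟩ _ => ?_
    by_cases ha : a = π s
    · subst ha
      simp only [hφ]
      rw [← hπ s, sub_self, mul_zero]
    · rw [hsupp (s, a) ha, zero_mul]
  have hφd : ∑ p, d p * φ p = 0 := by
    refine le_antisymm ?_ (Finset.sum_nonneg fun p _ => mul_nonneg (hd.1 p) (hφ0 p))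
    linarith [hsplit hd, hsplit he]
  refine ⟨regObj σ c w d, ⟨⟨d, hd, rfl⟩, ?_⟩, ⟨V, φ, hφ0, ?_⟩, ?_⟩
  · rintro _ ⟨x, hx, rfl⟩
    exact hmin hx
  · rw [kappa_eq_sum hd, regObj_eq_sum, ← sub_eq_zero, ← Finset.sum_sub_distrib, ← hφd]
    refine Finset.sum_congr rfl fun p _ => ?_
    simp only [hφ, hg]
    field_simp
    ring
  · rintro _ ⟨V', φ', hφ', rfl⟩
    exact kappa_le_regObj hσ hd c w V' hφ'
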